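/- Let T be a tree and v a vertex of T. Let ℓ be the minimum of dist(v,u) over all vertices u lying on some path of length diam(T), i.e. over all u for which there exist vertices a, b with dist(a,b) = diam(T) and dist(a,u) + dist(u,b) = diam(T). Then f_d(T, v) = diam(T) + ℓ + 1. -/

import Mathlib

open SimpleGraph

variable {V : Type*}

/-- The eccentricity of a vertex: the maximum graph distance to any vertex. -/
noncomputable def ecc [Fintype V] (G : SimpleGraph V) (u : V) : ℕ :=
  Finset.univ.sup fun w => G.dist u w

/-- The diameter of a graph: the maximum eccentricity. -/
noncomputable def graphDiam [Fintype V] (G : SimpleGraph V) : ℕ :=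
  Finset.univ.sup fun u => ecc G u

/-- A nonempty set `U` of vertices is closed if for every `u ∈ U` and every vertex `v`
there is `x ∈ U` with `dist u v = dist u x`. -/
def IsClosedSet (G : SimpleGraph V) (U : Set V) : Prop :=
  U.Nonempty ∧ ∀ u ∈ U, ∀ v : V, ∃ x ∈ U, G.dist u v = G.dist u x

/-- An Explorer strategy (assigning a called distance to each history, most recent
vertex first) is valid if, whenever the current vertex `u` has a legal call available
(`1 ≤ ecc u`), it calls some `k` with `1 ≤ k ≤ ecc u`. -/
def EValid [Fintype V] (G : SimpleGraph V) (ES : List V → ℕ) : Prop :=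
  ∀ h : List V, ∀ u : V, h.head? = some u → 1 ≤ ecc G u →
    1 ≤ ES h ∧ ES h ≤ ecc G u

/-- A Director strategy is valid if, for each history with current vertex `u` and each
legal called distance `k` (`1 ≤ k ≤ ecc u`), it answers a vertex at distance exactly `k`. -/
def DValid [Fintype V] (G : SimpleGraph V) (DS : List V → ℕ → V) : Prop :=
  ∀ h : List V, ∀ u : V, h.head? = some u → ∀ k : ℕ, 1 ≤ k → k ≤ ecc G u →
    G.dist u (DS h k) = k

/-- The history (most recent vertex first) of the first `n` moves of the play determined
by Explorer strategy `ES` and Director strategy `DS`, starting at `v`. -/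
def play (ES : List V → ℕ) (DS : List V → ℕ → V) (v : V) : ℕ → List V
  | 0 => [v]
  | n + 1 => DS (play ES DS v n) (ES (play ES DS v n)) :: play ES DS v n

/-- The number of distinct vertices visited in the play determined by `ES` and `DS`
starting at `v`. -/
noncomputable def playScore (ES : List V → ℕ) (DS : List V → ℕ → V) (v : V) : ℕ :=
  Set.ncard {x : V | ∃ n : ℕ, x ∈ play ES DS v n}

/-- `fd G v` : the max over valid Explorer strategies of the min over valid Director
strategies of the number of distinct vertices visited. -/
noncomputable def fd [Fintype V] (G : SimpleGraph V) (v : V) : ℕ :=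
  sSup {r : ℕ | ∃ ES : List V → ℕ, EValid G ES ∧
    r = sInf {s : ℕ | ∃ DS : List V → ℕ → V, DValid G DS ∧ s = playScore ES DS v}}

/-- A play `x` is consistent with the nonadaptive strategy `S` from start `v` if it starts
at `v` and each step has the prescribed length. -/
def NAConsistent (G : SimpleGraph V) (S : List ℕ) (v : V) (x : ℕ → V) : Prop :=
  x 0 = v ∧ ∀ i < S.length, G.dist (x i) (x (i + 1)) = S.getD i 0

/-- A nonadaptive strategy is playable from `v` if every consistent initial segment
can be extended. -/
def NAPlayable (G : SimpleGraph V) (S : List ℕ) (v : V) : Prop :=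
  ∀ x : ℕ → V, ∀ i < S.length, x 0 = v →
    (∀ j < i, G.dist (x j) (x (j + 1)) = S.getD j 0) →
    ∃ y : V, G.dist (x i) y = S.getD i 0

/-- The score of a nonadaptive strategy `S` from `v`: the minimum over consistent plays
of the number of distinct vertices among `x 0, …, x S.length`. -/
noncomputable def naScore (G : SimpleGraph V) (S : List ℕ) (v : V) : ℕ :=
  sInf {k : ℕ | ∃ x : ℕ → V, NAConsistent G S v x ∧
    k = Set.ncard {w : V | ∃ i ≤ S.length, x i = w}}

/-- The `n × m` grid graph: the box product of two path graphs. -/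
def gridGraph (n m : ℕ) : SimpleGraph (Fin n × Fin m) :=
  (pathGraph n) □ (pathGraph m)

/-- In a tree, two geodesics meeting only at their common endpoint concatenate to a geodesic. -/
lemma dist_eq_add_of_inter (G : SimpleGraph V) (hc : G.Connected) (ha : G.IsAcyclic) {v m a : V}
    (h : ∀ w, G.dist v w + G.dist w m = G.dist v m → G.dist m w + G.dist w a = G.dist m a → w = m) :
    G.dist v a = G.dist v m + G.dist m a := by
  classical
  have aligned : ∀ {x y : V} (p : G.Walk x y), p.length = G.dist x y → ∀ w ∈ p.support,
      G.dist x w + G.dist w y = G.dist x y := by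
    intro x y p hp w hw
    have h1 := congrArg Walk.length (p.take_spec hw)
    rw [Walk.length_append] at h1
    have h2 := dist_le (p.takeUntil w hw)
    have h3 := dist_le (p.dropUntil w hw)
    have h4 := hc.dist_triangle (u := x) (v := w) (w := y)
    omega
  obtain ⟨p, hp⟩ := hc.exists_walk_length_eq_dist v m
  obtain ⟨q, hq⟩ := hc.exists_walk_length_eq_dist m a
  obtain ⟨r, hr⟩ := hc.exists_walk_length_eq_dist v a
  have hpP := p.isPath_of_length_eq_dist hp
  have hqP := q.isPath_of_length_eq_dist hq
  have hrP := r.isPath_of_length_eq_dist hr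
  have hpq : (p.append q).IsPath := by
    rw [Walk.isPath_def, Walk.support_append, List.nodup_append']
    refine ⟨hpP.support_nodup, hqP.support_nodup.tail, ?_⟩
    intro w hw hw'
    have := h w (aligned p hp w hw) (aligned q hq w (List.mem_of_mem_tail hw'))
    subst this
    have h3 := hqP.support_nodup
    rw [← q.cons_tail_support, List.nodup_cons] at h3
    exact h3.1 hw'
  have := congrArg (fun x => Walk.length x.1) ((ha.subsingleton_path _ _).elim ⟨r, hrP⟩ ⟨_, hpq⟩)
  simp only [Walk.length_append] at this
  omega

/-- Every intermediate distance is realised on a geodesic. -/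
lemma exists_dist_eq_on_geodesic (G : SimpleGraph V) (hc : G.Connected) (x y : V) {k : ℕ}
    (hk : k ≤ G.dist x y) : ∃ z, G.dist x z = k ∧ G.dist x z + G.dist z y = G.dist x y := by
  obtain ⟨p, hp⟩ := hc.exists_walk_length_eq_dist x y
  have h1 := dist_le (p.take k)
  have h2 := dist_le (p.drop k)
  rw [Walk.take_length] at h1
  rw [Walk.drop_length] at h2
  have h4 := hc.dist_triangle (u := x) (v := p.getVert k) (w := y)
  exact ⟨p.getVert k, by omega, by omega⟩

/-- In a tree, a vertex on a geodesic is determined by its distance to an endpoint. -/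
lemma eq_of_dist_eq_on_geodesic (G : SimpleGraph V) (hc : G.Connected) (ha : G.IsAcyclic)
    {x y z w : V} (hz : G.dist x z + G.dist z y = G.dist x y)
    (hw : G.dist x w + G.dist w y = G.dist x y) (h : G.dist x z = G.dist x w) : z = w := by
  have key : ∀ z, G.dist x z + G.dist z y = G.dist x y →
      ∃ p : G.Walk x y, p.IsPath ∧ p.getVert (G.dist x z) = z := by
    intro z hz
    obtain ⟨p, hp⟩ := hc.exists_walk_length_eq_dist x z
    obtain ⟨q, hq⟩ := hc.exists_walk_length_eq_dist z y
    refine ⟨p.append q, Walk.isPath_of_length_eq_dist _ ?_, ?_⟩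
    · rw [Walk.length_append]; omega
    · rw [Walk.getVert_append, ← hp]; simp
  obtain ⟨p, hp, hpz⟩ := key z hz
  obtain ⟨q, hq, hqw⟩ := key w hw
  have : p = q := congrArg Subtype.val ((ha.subsingleton_path _ _).elim ⟨p, hp⟩ ⟨q, hq⟩)
  rw [← hpz, ← hqw, this, h]

/-- A vertex of a geodesic nearest to `v` is a gate towards the endpoint of the geodesic. -/
lemma dist_eq_add_of_nearest (G : SimpleGraph V) (hc : G.Connected) (ha : G.IsAcyclic)
    {v m a b : V} (hm : G.dist a m + G.dist m b = G.dist a b)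
    (hmin : ∀ w, G.dist a w + G.dist w b = G.dist a b → G.dist v m ≤ G.dist v w) :
    G.dist v a = G.dist v m + G.dist m a := by
  refine dist_eq_add_of_inter G hc ha fun w h1 h2 => ?_
  have h3 := hc.dist_triangle (u := a) (v := w) (w := b)
  have h4 := hc.dist_triangle (u := w) (v := m) (w := b)
  rw [G.dist_comm (u := m) (v := w), G.dist_comm (u := w) (v := a), G.dist_comm (u := m) (v := a)]
    at h2
  have h5 := hmin w (by omega)
  exact hc.dist_eq_zero_iff.1 (by omega)

/-- Any three vertices of a tree have a median. -/
lemma exists_median (G : SimpleGraph V) (hc : G.Connected) (ha : G.IsAcyclic) (v a b : V) :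
    ∃ m, G.dist a m + G.dist m b = G.dist a b ∧ G.dist v a = G.dist v m + G.dist m a ∧
      G.dist v b = G.dist v m + G.dist m b := by
  obtain ⟨m, hm, hmin⟩ := WellFounded.has_min (InvImage.wf (G.dist v) Nat.lt_wfRel.wf)
    {w | G.dist a w + G.dist w b = G.dist a b} ⟨a, by simp⟩
  have hmin' : ∀ w, G.dist a w + G.dist w b = G.dist a b → G.dist v m ≤ G.dist v w :=
    fun w hw => not_lt.1 (hmin w hw)
  refine ⟨m, hm, dist_eq_add_of_nearest G hc ha hm hmin',
    dist_eq_add_of_nearest G hc ha (b := a) ?_ fun w hw => hmin' w ?_⟩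
  · have : G.dist a m + G.dist m b = G.dist a b := hm
    rw [G.dist_comm (u := b) (v := m), G.dist_comm (u := m) (v := a), G.dist_comm (u := b) (v := a)]
    omega
  · rw [G.dist_comm (u := b) (v := w), G.dist_comm (u := w) (v := a),
      G.dist_comm (u := b) (v := a)] at hw
    omega

/-- The four-point condition in trees. -/
lemma four_point (G : SimpleGraph V) (hc : G.Connected) (ha : G.IsAcyclic) (x y p q : V) :
    G.dist x y + G.dist p q ≤ G.dist x p + G.dist y q ∨
      G.dist x y + G.dist p q ≤ G.dist x q + G.dist y p := by
  have key : ∀ x y m n : V, G.dist p m + G.dist m q = G.dist p q →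
      G.dist p n + G.dist n q = G.dist p q → G.dist x q = G.dist x m + G.dist m q →
      G.dist y p = G.dist y n + G.dist n p → G.dist p m ≤ G.dist p n →
      G.dist x y + G.dist p q ≤ G.dist x q + G.dist y p := by
    intro x y m n hm hn hx hy hle
    obtain ⟨z, hz, hz'⟩ := exists_dist_eq_on_geodesic G hc p n hle
    have h1 := hc.dist_triangle (u := p) (v := z) (w := q)
    have h2 := hc.dist_triangle (u := z) (v := n) (w := q)
    obtain rfl := eq_of_dist_eq_on_geodesic G hc ha hm (w := z) (by omega) hz.symm
    have h3 := hc.dist_triangle (u := x) (v := m) (w := y)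
    have h4 := hc.dist_triangle (u := m) (v := n) (w := y)
    rw [G.dist_comm (u := n) (v := y)] at h4
    rw [G.dist_comm (u := n) (v := p)] at hy
    omega
  obtain ⟨m, hm, hma, hmb⟩ := exists_median G hc ha x p q
  obtain ⟨n, hn, hna, hnb⟩ := exists_median G hc ha y p q
  rcases le_total (G.dist p m) (G.dist p n) with h | h
  · exact Or.inr (key x y m n hm hn hmb hna h)
  · have := key y x n m hn hm hnb hma h
    rw [G.dist_comm (u := y) (v := x)] at this
    omega

/-- If `u` separates `a` from `x`, it separates `a` from all vertices closer to `x` than `u`. -/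
lemma gate_of_dist_lt (G : SimpleGraph V) (hc : G.Connected) (ha : G.IsAcyclic) {a u x y : V}
    (h : G.dist x a = G.dist x u + G.dist u a) (hlt : G.dist x y < G.dist x u) :
    G.dist y a = G.dist y u + G.dist u a := by
  have h1 := hc.dist_triangle (u := y) (v := u) (w := a)
  have h2 := four_point G hc ha a x u y
  rw [G.dist_comm (u := a) (v := x), G.dist_comm (u := a) (v := u), G.dist_comm (u := a) (v := y),
    G.dist_comm (u := u) (v := y)] at h2
  omega

/-- `ForcedExit G A U n x`: from `x`, calls allowed by `A` force the token out of `U` within `n`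
moves. -/
def ForcedExit (G : SimpleGraph V) (A : V → ℕ → Prop) (U : Finset V) : ℕ → V → Prop
  | 0, x => x ∉ U
  | n + 1, x => ForcedExit G A U n x ∨ ∃ k, A x k ∧ ∀ y, G.dist x y = k → ForcedExit G A U n y

lemma ForcedExit.mono {G : SimpleGraph V} {A : V → ℕ → Prop} {U : Finset V} {m n : ℕ} (h : m ≤ n)
    {x : V} (hx : ForcedExit G A U m x) : ForcedExit G A U n x := by
  induction h with
  | refl => exact hx
  | step _ ih => exact Or.inl ih

/-- A set realising all distances below `n` from `x` has at least `n` elements. -/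
lemma le_card_of_forall_exists_dist (G : SimpleGraph V) (x : V) (n : ℕ) (W : Finset V)
    (h : ∀ k < n, ∃ y ∈ W, G.dist x y = k) : n ≤ W.card := by
  classical
  calc n = (Finset.range n).card := (Finset.card_range n).symm
    _ ≤ (W.image (G.dist x)).card := Finset.card_le_card fun k hk => by
        obtain ⟨y, hy, hyk⟩ := h k (Finset.mem_range.1 hk)
        exact Finset.mem_image.2 ⟨y, hy, hyk⟩
    _ ≤ W.card := Finset.card_image_le

section Finite

variable [Fintype V]

lemma dist_le_ecc (G : SimpleGraph V) (x y : V) : G.dist x y ≤ ecc G x :=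
  Finset.le_sup (f := fun w => G.dist x w) (Finset.mem_univ y)

lemma exists_dist_eq_ecc (G : SimpleGraph V) (x : V) : ∃ y, G.dist x y = ecc G x := by
  obtain ⟨y, -, hy⟩ := Finset.exists_mem_eq_sup Finset.univ ⟨x, Finset.mem_univ x⟩
    fun w => G.dist x w
  exact ⟨y, hy.symm⟩

lemma ecc_le_graphDiam (G : SimpleGraph V) (x : V) : ecc G x ≤ graphDiam G :=
  Finset.le_sup (f := fun w => ecc G w) (Finset.mem_univ x)

lemma dist_le_graphDiam (G : SimpleGraph V) (x y : V) : G.dist x y ≤ graphDiam G :=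
  (dist_le_ecc G x y).trans (ecc_le_graphDiam G x)

lemma exists_dist_eq_graphDiam (G : SimpleGraph V) (v : V) : ∃ a b, G.dist a b = graphDiam G := by
  obtain ⟨a, -, h⟩ := Finset.exists_mem_eq_sup Finset.univ ⟨v, Finset.mem_univ v⟩
    fun w => ecc G w
  obtain ⟨b, hb⟩ := exists_dist_eq_ecc G a
  exact ⟨a, b, hb.trans h.symm⟩

lemma exists_dist_eq_of_le_ecc (G : SimpleGraph V) (hc : G.Connected) (x : V) {k : ℕ}
    (hk : k ≤ ecc G x) : ∃ y, G.dist x y = k := by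
  obtain ⟨y, hy⟩ := exists_dist_eq_ecc G x
  obtain ⟨z, hz, -⟩ := exists_dist_eq_on_geodesic G hc x y (hk.trans hy.ge)
  exact ⟨z, hz⟩

/-- A vertex farthest from some vertex of a tree has maximum eccentricity. -/
lemma ecc_eq_graphDiam_of_farthest (G : SimpleGraph V) (hc : G.Connected) (ha : G.IsAcyclic)
    {x a : V} (h : G.dist x a = ecc G x) : ecc G a = graphDiam G := by
  obtain ⟨p, q, hpq⟩ := exists_dist_eq_graphDiam G x
  have h1 := four_point G hc ha x a p q
  have h2 := dist_le_ecc G x p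
  have h3 := dist_le_ecc G x q
  have h4 := dist_le_ecc G a p
  have h5 := dist_le_ecc G a q
  have h6 := ecc_le_graphDiam G a
  omega

/-- In a tree, eccentricities are attained at an endpoint of any fixed diametral pair. -/
lemma ecc_le_of_diametral (G : SimpleGraph V) (hc : G.Connected) (ha : G.IsAcyclic)
    {a b : V} (hab : G.dist a b = graphDiam G) (w : V) :
    ecc G w ≤ G.dist w a ∨ ecc G w ≤ G.dist w b := by
  obtain ⟨y, hy⟩ := exists_dist_eq_ecc G w
  have h1 := four_point G hc ha w y a b
  have h2 := dist_le_graphDiam G y a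
  have h3 := dist_le_graphDiam G y b
  omega

/-- The distance from `x` to the union of all diametral paths. -/
noncomputable def distDiametral (G : SimpleGraph V) (x : V) : ℕ :=
  sInf {d : ℕ | ∃ u a b : V, G.dist a b = graphDiam G ∧
    G.dist a u + G.dist u b = graphDiam G ∧ d = G.dist x u}

lemma distDiametral_le (G : SimpleGraph V) (x : V) {u a b : V} (hab : G.dist a b = graphDiam G)
    (hu : G.dist a u + G.dist u b = graphDiam G) : distDiametral G x ≤ G.dist x u :=
  Nat.sInf_le ⟨u, a, b, hab, hu, rfl⟩

lemma exists_dist_eq_distDiametral (G : SimpleGraph V) (x : V) :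
    ∃ u a b : V, G.dist a b = graphDiam G ∧ G.dist a u + G.dist u b = graphDiam G ∧
      distDiametral G x = G.dist x u := by
  obtain ⟨a, b, hab⟩ := exists_dist_eq_graphDiam G x
  exact Nat.sInf_mem (s := {d : ℕ | ∃ u a b : V, G.dist a b = graphDiam G ∧
    G.dist a u + G.dist u b = graphDiam G ∧ d = G.dist x u}) ⟨_, a, a, b, hab, by simp [hab], rfl⟩

lemma distDiametral_le_add (G : SimpleGraph V) (hc : G.Connected) (x y : V) :
    distDiametral G x ≤ G.dist x y + distDiametral G y := by
  obtain ⟨u, a, b, hab, hu, h⟩ := exists_dist_eq_distDiametral G y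
  rw [h]
  exact (distDiametral_le G x hab hu).trans hc.dist_triangle

lemma distDiametral_le_ecc (G : SimpleGraph V) (x : V) : distDiametral G x ≤ ecc G x := by
  obtain ⟨u, a, b, hab, hu, h⟩ := exists_dist_eq_distDiametral G x
  exact h.trans_le (dist_le_ecc G x u)

/-- The Director can stay in a closed set containing the start. -/
lemma exists_director_le_ncard (G : SimpleGraph V) {U : Set V} (hU : IsClosedSet G U)
    (hc : G.Connected) {v : V} (hv : v ∈ U) (ES : List V → ℕ) :
    ∃ DS, DValid G DS ∧ playScore ES DS v ≤ U.ncard := by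
  classical
  let DS : List V → ℕ → V := fun h k =>
    if h₁ : ∃ y ∈ U, G.dist (h.headD v) y = k then h₁.choose
    else if h₂ : ∃ y, G.dist (h.headD v) y = k then h₂.choose else h.headD v
  refine ⟨DS, ?_, Set.ncard_le_ncard ?_ U.toFinite⟩
  · intro h u hu k _ hk
    have hd : h.headD v = u := by rw [List.headD_eq_head?_getD, hu]; rfl
    have h₂ : ∃ y, G.dist (h.headD v) y = k := hd ▸ exists_dist_eq_of_le_ecc G hc u hk
    rw [← hd]
    by_cases h₁ : ∃ y ∈ U, G.dist (h.headD v) y = k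
    · simp only [DS, dif_pos h₁]; exact h₁.choose_spec.2
    · simp only [DS, dif_neg h₁, dif_pos h₂]; exact h₂.choose_spec
  · rintro x ⟨n, hx⟩
    have key : ∀ n, (∀ x ∈ play ES DS v n, x ∈ U) ∧
        (play ES DS v n).head? = some ((play ES DS v n).headD v) := by
      intro n
      induction n with
      | zero => simp [play, hv]
      | succ n ih =>
        obtain ⟨ih, hh⟩ := ih
        refine ⟨?_, rfl⟩
        simp only [play, List.mem_cons, forall_eq_or_imp]
        refine ⟨?_, ih⟩
        have hmem : (play ES DS v n).headD v ∈ U := ih _ (List.mem_of_mem_head? hh)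
        by_cases h₁ : ∃ y ∈ U, G.dist ((play ES DS v n).headD v) y = ES (play ES DS v n)
        · simp only [DS, dif_pos h₁]; exact h₁.choose_spec.1
        by_cases h₂ : ∃ y, G.dist ((play ES DS v n).headD v) y = ES (play ES DS v n)
        · obtain ⟨y, hy⟩ := h₂
          obtain ⟨x, hx, hxy⟩ := hU.2 _ hmem y
          exact absurd ⟨x, hx, hxy ▸ hy⟩ h₁
        · simp only [DS, dif_neg h₁, dif_neg h₂]; exact hmem
    exact (key n).1 x hx

/-- A diametral path together with the path joining it to `v` is a closed set. -/
lemma exists_closed_ncard_le (G : SimpleGraph V) (hc : G.Connected) (ha : G.IsAcyclic) (v : V) :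
    ∃ U : Set V, IsClosedSet G U ∧ v ∈ U ∧ U.ncard ≤ graphDiam G + distDiametral G v + 1 := by
  obtain ⟨u, a, b, hab, hu, hl⟩ := exists_dist_eq_distDiametral G v
  set P : Set V := {x | G.dist a x + G.dist x b = G.dist a b} with hP
  set Q : Set V := {x | G.dist v x + G.dist x u = G.dist v u} with hQ
  have hua : G.dist v a = G.dist v u + G.dist u a :=
    dist_eq_add_of_nearest G hc ha (hu.trans hab.symm)
      fun w hw => hl ▸ distDiametral_le G v hab (hw.trans hab)
  have hub : G.dist v b = G.dist v u + G.dist u b := by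
    refine dist_eq_add_of_nearest G hc ha (b := a) ?_
      fun w hw => hl ▸ distDiametral_le G v (a := b) (b := a) (G.dist_comm.trans hab)
        (hw.trans (G.dist_comm.trans hab))
    rw [G.dist_comm (u := b) (v := u), G.dist_comm (u := u) (v := a), G.dist_comm (u := b) (v := a)]
    omega
  have huP : u ∈ P := hu.trans hab.symm
  have hPe : ∀ e ∈ ({a, b} : Set V), ∀ w ∈ P, ∀ z, G.dist w z + G.dist z e = G.dist w e → z ∈ P := by
    rintro e (rfl | rfl) w hw z hz
    · have h1 := hc.dist_triangle (u := z) (v := w) (w := b)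
      have h2 := hc.dist_triangle (u := e) (v := z) (w := b)
      simp only [hP, Set.mem_ofPred_eq] at hw ⊢
      rw [G.dist_comm (u := w) (v := e), G.dist_comm (u := z) (v := e),
        G.dist_comm (u := w) (v := z)] at hz
      omega
    · have h1 := hc.dist_triangle (u := a) (v := w) (w := z)
      have h2 := hc.dist_triangle (u := a) (v := z) (w := e)
      simp only [hP, Set.mem_ofPred_eq] at hw ⊢
      omega
  refine ⟨P ∪ Q, ⟨⟨u, Or.inl huP⟩, ?_⟩, Or.inr (by simp [hQ]), ?_⟩
  · intro w hw y
    obtain ⟨e, he, hle, hue⟩ : ∃ e ∈ ({a, b} : Set V), ecc G w ≤ G.dist w e ∧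
        G.dist v e = G.dist v u + G.dist u e := by
      rcases ecc_le_of_diametral G hc ha hab w with h | h
      · exact ⟨a, by simp, h, hua⟩
      · exact ⟨b, by simp, h, hub⟩
    have hk := (dist_le_ecc G w y).trans hle
    rcases hw with hw | hw
    · obtain ⟨z, hz, hz'⟩ := exists_dist_eq_on_geodesic G hc w e hk
      exact ⟨z, Or.inl (hPe e he w hw z hz'), hz.symm⟩
    · simp only [hQ, Set.mem_ofPred_eq] at hw
      have h1 := hc.dist_triangle (u := v) (v := w) (w := e)
      have h2 := hc.dist_triangle (u := w) (v := u) (w := e)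
      rcases le_total (G.dist w y) (G.dist w u) with h | h
      · obtain ⟨z, hz, hz'⟩ := exists_dist_eq_on_geodesic G hc w u h
        have h3 := hc.dist_triangle (u := v) (v := w) (w := z)
        have h4 := hc.dist_triangle (u := v) (v := z) (w := u)
        refine ⟨z, Or.inr ?_, hz.symm⟩
        simp only [hQ, Set.mem_ofPred_eq]
        omega
      · obtain ⟨z, hz, hz'⟩ := exists_dist_eq_on_geodesic G hc u e
          (k := G.dist w y - G.dist w u) (by omega)
        have h3 := hc.dist_triangle (u := w) (v := u) (w := z)
        have h4 := hc.dist_triangle (u := w) (v := z) (w := e)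
        exact ⟨z, Or.inl (hPe e he u huP z hz'), by omega⟩
  · have hPc : P.ncard ≤ graphDiam G + 1 := by
      rw [← Finset.card_range (graphDiam G + 1), ← Set.ncard_coe_finset]
      refine Set.ncard_le_ncard_of_injOn (G.dist a) ?_ ?_
      · intro x hx
        simp only [hP, Set.mem_ofPred_eq] at hx
        simp only [Finset.coe_range, Set.mem_Iio]
        omega
      · exact fun x hx y hy h => eq_of_dist_eq_on_geodesic G hc ha hx hy h
    have hQc : (Q \ P).ncard ≤ distDiametral G v := by
      rw [← Finset.card_range (distDiametral G v), ← Set.ncard_coe_finset]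
      refine Set.ncard_le_ncard_of_injOn (G.dist v) ?_ ?_
      · intro x hx
        have h1 : G.dist v x + G.dist x u = G.dist v u := hx.1
        have h2 : G.dist x u ≠ 0 := fun h => hx.2 (hc.dist_eq_zero_iff.1 h ▸ huP)
        simp only [Finset.coe_range, Set.mem_Iio]
        omega
      · exact fun x hx y hy h => eq_of_dist_eq_on_geodesic G hc ha hx.1 hy.1 h
    have := Set.ncard_union_le P (Q \ P)
    rw [Set.union_sdiff_self] at this
    omega

/-- If no nonempty subset of `U` is closed under allowed calls, then exit is forced everywhere. -/
lemma exists_forcedExit (G : SimpleGraph V) (A : V → ℕ → Prop) (U : Finset V)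
    (h : ∀ W ⊆ U, W.Nonempty → ¬ ∀ x ∈ W, ∀ k, A x k → ∃ y ∈ W, G.dist x y = k) (x : V) :
    ∃ n, ForcedExit G A U n x := by
  classical
  by_contra hx
  have mem : ∀ y, (¬ ∃ n, ForcedExit G A U n y) → y ∈ U :=
    fun y hy => by_contra fun hyU => hy ⟨0, hyU⟩
  refine h (U.filter fun x => ¬ ∃ n, ForcedExit G A U n x) (Finset.filter_subset _ _)
    ⟨x, Finset.mem_filter.2 ⟨mem x hx, hx⟩⟩ fun z hz k hk => ?_
  by_contra hno
  have hex : ∀ y, ∃ n, G.dist z y = k → ForcedExit G A U n y := by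
    intro y
    by_cases hy : G.dist z y = k
    · by_contra hn
      have hy' : ¬ ∃ n, ForcedExit G A U n y := fun ⟨n, h⟩ => hn ⟨n, fun _ => h⟩
      exact hno ⟨y, Finset.mem_filter.2 ⟨mem y hy', hy'⟩, hy⟩
    · exact ⟨0, fun h => absurd h hy⟩
  choose f hf using hex
  exact (Finset.mem_filter.1 hz).2 ⟨Finset.univ.sup f + 1,
    Or.inr ⟨k, hk, fun y hy => (hf y hy).mono (Finset.le_sup (Finset.mem_univ y))⟩⟩

open Classical in
/-- The Explorer forces `N` distinct vertices if, as long as fewer than `N` vertices are visited,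
the calls allowed by `A` maintain an invariant which forbids closed sets of visited vertices. -/
lemma exists_explorer_le_playScore (G : SimpleGraph V) (A : Finset V → V → ℕ → Prop)
    (hA : ∀ U x k, A U x k → 1 ≤ k ∧ k ≤ ecc G x) (Inv : Finset V → Prop) (N : ℕ) (v : V)
    (h0 : Inv {v})
    (hstep : ∀ U x y, Inv U → x ∈ U → A U x (G.dist x y) → Inv (insert y U))
    (hclosed : ∀ U, Inv U → U.card < N → ∀ W ⊆ U, W.Nonempty →
      ¬ ∀ x ∈ W, ∀ k, A U x k → ∃ y ∈ W, G.dist x y = k) :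
    ∃ ES, EValid G ES ∧ ∀ DS, DValid G DS → N ≤ playScore ES DS v := by
  have hES : ∀ h : List V, ∃ k, ∀ x, h.head? = some x →
      (1 ≤ ecc G x → 1 ≤ k ∧ k ≤ ecc G x) ∧
      ((∃ n, ForcedExit G (A h.toFinset) h.toFinset n x) → A h.toFinset x k ∧
        ∃ s, (∀ y, G.dist x y = k → ForcedExit G (A h.toFinset) h.toFinset s y) ∧
          ∀ n, ForcedExit G (A h.toFinset) h.toFinset n x → s < n) := by
    intro h
    cases h with
    | nil => exact ⟨0, by simp⟩
    | cons x t =>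
      simp only [List.head?_cons, Option.some.injEq, forall_eq']
      by_cases hx : ∃ n, ForcedExit G (A (x :: t).toFinset) (x :: t).toFinset n x
      · have hspec := Nat.find_spec hx
        have hmin : ∀ n, ForcedExit G (A (x :: t).toFinset) (x :: t).toFinset n x →
            Nat.find hx ≤ n := fun n hn => Nat.find_min' hx hn
        generalize Nat.find hx = r at hspec hmin
        cases r with
        | zero => exact absurd hspec (by simp [ForcedExit])
        | succ s =>
          rcases hspec with hs | ⟨k, hk, hs⟩
          · exact absurd (hmin s hs) (by omega)
          · exact ⟨k, fun _ => hA _ _ _ hk, fun _ => ⟨hk, s, hs, hmin⟩⟩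
      · exact ⟨1, fun h => ⟨le_rfl, h⟩, fun h => absurd h hx⟩
  choose ES hES using hES
  refine ⟨ES, fun h u hu => (hES h u hu).1, fun DS hDS => ?_⟩
  by_contra! hlt
  set p := play ES DS v with hp
  have hsucc : ∀ n, p (n + 1) = DS (p n) (ES (p n)) :: p n := fun n => rfl
  have hhead : ∀ n, (p n).head? = some ((p n).headD v) := by
    rintro (_ | n) <;> rfl
  have hmem : ∀ n, (p n).headD v ∈ (p n).toFinset :=
    fun n => List.mem_toFinset.2 (List.mem_of_mem_head? (hhead n))
  have hcard : ∀ n, (p n).toFinset.card < N := by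
    intro n
    refine lt_of_le_of_lt ?_ hlt
    rw [← Set.ncard_coe_finset]
    exact Set.ncard_le_ncard (fun x hx => ⟨n, List.mem_toFinset.1 hx⟩) (Set.toFinite _)
  have hmove : ∀ n, Inv (p n).toFinset →
      A (p n).toFinset ((p n).headD v) (ES (p n)) ∧
      G.dist ((p n).headD v) ((p (n + 1)).headD v) = ES (p n) ∧
      ∃ s, ForcedExit G (A (p n).toFinset) (p n).toFinset s ((p (n + 1)).headD v) ∧
        ∀ r, ForcedExit G (A (p n).toFinset) (p n).toFinset r ((p n).headD v) → s < r := by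
    intro n hn
    obtain ⟨h1, s, h2, h3⟩ := (hES (p n) _ (hhead n)).2
      (exists_forcedExit G _ _ (hclosed _ hn (hcard n)) _)
    obtain ⟨hk1, hk2⟩ := hA _ _ _ h1
    have hd : G.dist ((p n).headD v) ((p (n + 1)).headD v) = ES (p n) :=
      hDS _ _ (hhead n) _ hk1 hk2
    exact ⟨h1, hd, s, h2 _ hd, h3⟩
  have hinv : ∀ n, Inv (p n).toFinset := by
    intro n
    induction n with
    | zero => simpa [hp, play] using h0
    | succ n ih =>
      obtain ⟨h1, h2, -⟩ := hmove n ih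
      rw [hsucc, List.toFinset_cons]
      have h3 : A (p n).toFinset ((p n).headD v)
          (G.dist ((p n).headD v) ((p (n + 1)).headD v)) := by rwa [h2]
      exact hstep _ _ _ ih (hmem n) h3
  have hmono : Monotone fun n => (p n).toFinset := by
    refine monotone_nat_of_le_succ fun n => ?_
    simp only [hsucc, List.toFinset_cons]
    exact Finset.subset_insert _ _
  obtain ⟨n₀, hn₀⟩ := wellFoundedGT_iff_monotone_chain_condition.1
    (inferInstance : WellFoundedGT (Finset V)) ⟨fun n => (p n).toFinset, hmono⟩
  replace hn₀ : ∀ m, n₀ ≤ m → (p m).toFinset = (p n₀).toFinset := fun m hm => (hn₀ m hm).symm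
  have hnot : ∀ r n, n₀ ≤ n →
      ¬ ForcedExit G (A (p n₀).toFinset) (p n₀).toFinset r ((p n).headD v) := by
    intro r
    induction r using Nat.strong_induction_on with
    | _ r ih =>
      intro n hn hr
      obtain ⟨-, -, s, hs, hmin⟩ := hmove n (hinv n)
      rw [hn₀ n hn] at hs hmin
      exact ih s (hmin r hr) (n + 1) (by omega) hs
  obtain ⟨r, hr⟩ := exists_forcedExit G _ _ (hclosed _ (hinv n₀) (hcard n₀)) ((p n₀).headD v)
  exact hnot r n₀ le_rfl hr

/-- The vertices outside all diametral paths that are separated from the ends of diametral paths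
by the same vertices as `v`. -/
def diametralBranch (G : SimpleGraph V) (v : V) : Set V :=
  {y | 1 ≤ distDiametral G y ∧ ∀ a b m, G.dist a b = graphDiam G →
    G.dist a m + G.dist m b = graphDiam G → ∀ e, G.dist v e = G.dist v m + G.dist m e →
      G.dist y e = G.dist y m + G.dist m e}

lemma mem_diametralBranch_of_dist_lt (G : SimpleGraph V) (hc : G.Connected) (ha : G.IsAcyclic)
    {v x y : V} (hx : x ∈ diametralBranch G v) (h : G.dist x y < distDiametral G x) :
    y ∈ diametralBranch G v := by
  have h1 := distDiametral_le_add G hc x y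
  refine ⟨by omega, fun a b m hab hm e he => ?_⟩
  exact gate_of_dist_lt G hc ha (hx.2 a b m hab hm e he)
    (h.trans_le (distDiametral_le G x hab hm))

/-- The calls made by the Explorer: until as many vertices are visited as the distance from `v` to
the diametral paths, only short calls are allowed, so that the token approaches the diametral
paths slowly. -/
def SlowCall (G : SimpleGraph V) (v : V) (U : Finset V) (x : V) (k : ℕ) : Prop :=
  1 ≤ k ∧ k ≤ ecc G x ∧
    (U.card < distDiametral G v → k + distDiametral G v ≤ distDiametral G x + U.card)

open Classical in
/-- The invariant of the Explorer's strategy. -/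
def SlowDescent (G : SimpleGraph V) (v : V) (U : Finset V) : Prop :=
  U.Nonempty ∧
  min (distDiametral G v) U.card ≤ (U.filter (· ∈ diametralBranch G v)).card ∧
  ∀ t < distDiametral G v, (∃ x ∈ U, distDiametral G x ≤ t) →
    distDiametral G v ≤ (U.filter (t < distDiametral G ·)).card + t

lemma slowDescent_singleton (G : SimpleGraph V) (v : V) : SlowDescent G v {v} := by
  classical
  refine ⟨Finset.singleton_nonempty v, ?_, ?_⟩
  · rcases Nat.eq_zero_or_pos (distDiametral G v) with h | h
    · simp [h]
    · have : v ∈ diametralBranch G v := ⟨h, fun _ _ _ _ _ _ he => he⟩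
      simp [Finset.filter_singleton, this]
  · rintro t ht ⟨x, hx, hxt⟩
    rw [Finset.mem_singleton.1 hx] at hxt
    omega

lemma SlowDescent.le_add_card {G : SimpleGraph V} {v : V} {U : Finset V} (h : SlowDescent G v U)
    {x : V} (hx : x ∈ U) : distDiametral G v + 1 ≤ distDiametral G x + U.card := by
  classical
  have hpos := h.1.card_pos
  by_cases hlt : distDiametral G x < distDiametral G v
  · have h1 := h.2.2 _ hlt ⟨x, hx, le_rfl⟩
    have h2 : (U.filter (distDiametral G x < distDiametral G ·)).card < U.card :=
      Finset.card_lt_card (Finset.filter_ssubset.2 ⟨x, hx, lt_irrefl _⟩)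
    omega
  · omega

open Classical in
lemma SlowDescent.insert {G : SimpleGraph V} (hc : G.Connected) (ha : G.IsAcyclic) {v x y : V}
    {U : Finset V} (h : SlowDescent G v U) (hx : x ∈ U) (hxy : SlowCall G v U x (G.dist x y)) :
    SlowDescent G v (insert y U) := by
  obtain ⟨h0, h1, h2⟩ := h
  obtain ⟨hk1, -, hk2⟩ := hxy
  by_cases hy : y ∈ U
  · rw [Finset.insert_eq_of_mem hy]; exact ⟨h0, h1, h2⟩
  have hht : distDiametral G v ≤ distDiametral G y + U.card := by
    have := distDiametral_le_add G hc x y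
    by_cases hlt : U.card < distDiametral G v
    · have := hk2 hlt; omega
    · omega
  refine ⟨Finset.insert_nonempty _ _, ?_, ?_⟩
  · rw [Finset.card_insert_of_notMem hy]
    by_cases hlt : U.card < distDiametral G v
    · have hall : U.filter (· ∈ diametralBranch G v) = U :=
        Finset.eq_of_subset_of_card_le (Finset.filter_subset _ _) (by omega)
      have hxC : x ∈ diametralBranch G v := (Finset.mem_filter.1 (hall.symm ▸ hx)).2
      have hyC : y ∈ diametralBranch G v :=
        mem_diametralBranch_of_dist_lt G hc ha hxC (by have := hk2 hlt; omega)
      rw [Finset.filter_insert, if_pos hyC, hall, Finset.card_insert_of_notMem hy]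
      exact min_le_right _ _
    · have := Finset.card_le_card
        (Finset.filter_subset_filter (· ∈ diametralBranch G v) (Finset.subset_insert y U))
      omega
  · intro t ht hex
    have hmono := Finset.card_le_card
      (Finset.filter_subset_filter (t < distDiametral G ·) (Finset.subset_insert y U))
    by_cases hU : ∃ x ∈ U, distDiametral G x ≤ t
    · have := h2 t ht hU
      omega
    · have hall : U.filter (t < distDiametral G ·) = U :=
        Finset.filter_true_of_mem fun z hz => not_le.1 fun hzt => hU ⟨z, hz, hzt⟩
      obtain ⟨z, hz, hzt⟩ := hex
      rcases Finset.mem_insert.1 hz with rfl | hz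
      · rw [hall] at hmono
        omega
      · exact absurd ⟨z, hz, hzt⟩ hU

lemma SlowDescent.not_closed_of_card_lt {G : SimpleGraph V} {v : V} {U : Finset V}
    (h : SlowDescent G v U) (hU : U.card < distDiametral G v) {W : Finset V} (hW : W ⊆ U)
    (hne : W.Nonempty) : ¬ ∀ x ∈ W, ∀ k, SlowCall G v U x k → ∃ y ∈ W, G.dist x y = k := by
  classical
  intro hcl
  obtain ⟨x, hx, hmax⟩ := W.exists_max_image (distDiametral G) hne
  have h1 := h.le_add_card (hW hx)
  have h2 := distDiametral_le_ecc G x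
  have hWc := le_card_of_forall_exists_dist G x
    (distDiametral G x + U.card - distDiametral G v + 1) W fun k hk => by
      rcases Nat.eq_zero_or_pos k with rfl | hk0
      · exact ⟨x, hx, SimpleGraph.dist_self⟩
      · exact hcl x hx k ⟨hk0, by omega, fun _ => by omega⟩
  have hWU := Finset.card_le_card hW
  by_cases hlt : distDiametral G x < distDiametral G v
  · have h3 := h.2.2 _ hlt ⟨x, hW hx, le_rfl⟩
    have hdisj : Disjoint W (U.filter (distDiametral G x < distDiametral G ·)) :=
      Finset.disjoint_left.2 fun z hz hz' => (Finset.mem_filter.1 hz').2.not_ge (hmax z hz)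
    have h4 := Finset.card_le_card (Finset.union_subset hW
      (Finset.filter_subset (distDiametral G x < distDiametral G ·) U))
    rw [Finset.card_union_of_disjoint hdisj] at h4
    omega
  · omega

lemma SlowDescent.not_closed_of_le_card {G : SimpleGraph V} (hc : G.Connected) (ha : G.IsAcyclic)
    {v : V} {U : Finset V} (h : SlowDescent G v U) (hU : distDiametral G v ≤ U.card)
    (hlt : U.card < graphDiam G + distDiametral G v + 1) {W : Finset V} (hW : W ⊆ U)
    (hne : W.Nonempty) : ¬ ∀ x ∈ W, ∀ k, SlowCall G v U x k → ∃ y ∈ W, G.dist x y = k := by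
  classical
  intro hcl
  replace hcl : ∀ x ∈ W, ∀ k ≤ ecc G x, ∃ y ∈ W, G.dist x y = k := by
    intro x hx k hk
    rcases Nat.eq_zero_or_pos k with rfl | hk0
    · exact ⟨x, hx, SimpleGraph.dist_self⟩
    · exact hcl x hx k ⟨hk0, hk, fun h => by omega⟩
  obtain ⟨x, hx⟩ := hne
  obtain ⟨a, haW, hxa⟩ := hcl x hx _ le_rfl
  have hea := ecc_eq_graphDiam_of_farthest G hc ha hxa
  obtain ⟨b, hbW, hab⟩ := hcl a haW _ hea.ge
  obtain ⟨m, hm, hva, hvb⟩ := exists_median G hc ha v a b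
  rw [hab] at hm
  have hY := le_card_of_forall_exists_dist G a (G.dist a m + 1)
    (W.filter (G.dist a · ≤ G.dist a m)) fun k hk => by
      obtain ⟨y, hy, hyk⟩ := hcl a haW k (by omega)
      exact ⟨y, Finset.mem_filter.2 ⟨hy, by omega⟩, hyk⟩
  have hZ := le_card_of_forall_exists_dist G b (G.dist m b)
    (W.filter (G.dist b · < G.dist m b)) fun k hk => by
      have := dist_le_ecc G b m
      rw [G.dist_comm] at this
      obtain ⟨y, hy, hyk⟩ := hcl b hbW k (by omega)
      exact ⟨y, Finset.mem_filter.2 ⟨hy, by omega⟩, hyk⟩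
  have hC := h.2.1
  rw [min_eq_left hU] at hC
  have hYZ : Disjoint (W.filter (G.dist a · ≤ G.dist a m)) (W.filter (G.dist b · < G.dist m b)) := by
    refine Finset.disjoint_left.2 fun z hz hz' => ?_
    have h1 := (Finset.mem_filter.1 hz).2
    have h2 := (Finset.mem_filter.1 hz').2
    have h3 := hc.dist_triangle (u := a) (v := z) (w := b)
    rw [G.dist_comm (u := z) (v := b)] at h3
    omega
  have hYZC : Disjoint (W.filter (G.dist a · ≤ G.dist a m) ∪ W.filter (G.dist b · < G.dist m b))
      (U.filter (· ∈ diametralBranch G v)) := by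
    refine Finset.disjoint_left.2 fun z hz hz' => ?_
    obtain ⟨hz1, hz2⟩ := (Finset.mem_filter.1 hz').2
    have h1 := hz2 a b m hab hm a hva
    have h2 := hz2 a b m hab hm b hvb
    have h3 := distDiametral_le G z hab hm
    rw [G.dist_comm (u := z) (v := a), G.dist_comm (u := m) (v := a)] at h1
    rw [G.dist_comm (u := z) (v := b)] at h2
    rcases Finset.mem_union.1 hz with hz | hz
    · have := (Finset.mem_filter.1 hz).2
      omega
    · have := (Finset.mem_filter.1 hz).2
      omega
  have hsub := Finset.card_le_card (Finset.union_subset (Finset.union_subset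
    ((Finset.filter_subset (G.dist a · ≤ G.dist a m) W).trans hW)
    ((Finset.filter_subset (G.dist b · < G.dist m b) W).trans hW))
    (Finset.filter_subset (· ∈ diametralBranch G v) U))
  rw [Finset.card_union_of_disjoint hYZC, Finset.card_union_of_disjoint hYZ] at hsub
  omega

lemma exists_explorer_graphDiam_le_playScore (G : SimpleGraph V) (hc : G.Connected)
    (ha : G.IsAcyclic) (v : V) :
    ∃ ES, EValid G ES ∧ ∀ DS, DValid G DS →
      graphDiam G + distDiametral G v + 1 ≤ playScore ES DS v := by
  refine exists_explorer_le_playScore G (SlowCall G v) (fun U x k h => ⟨h.1, h.2.1⟩)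
    (SlowDescent G v) _ v (slowDescent_singleton G v)
    (fun U x y h hx hxy => h.insert hc ha hx hxy) fun U h hU W hW hne => ?_
  rcases lt_or_ge U.card (distDiametral G v) with hlt | hge
  · exact h.not_closed_of_card_lt hlt hW hne
  · exact h.not_closed_of_le_card hc ha hge hU hW hne

end Finite

/-- For a tree `T` and vertex `v`, with `ℓ` the minimum distance from `v`
to a vertex lying on some path of length `diam(T)`, `f_d(T, v) = diam(T) + ℓ + 1`. -/
theorem stmt_11 {V : Type*} [Fintype V] (G : SimpleGraph V)
    (hc : G.Connected) (ha : G.IsAcyclic) (v : V) :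
    fd G v = graphDiam G +
      sInf {d : ℕ | ∃ u a b : V, G.dist a b = graphDiam G ∧
        G.dist a u + G.dist u b = graphDiam G ∧ d = G.dist v u} + 1 := by
  obtain ⟨U, hU, hvU, hUc⟩ := exists_closed_ncard_le G hc ha v
  have hup : ∀ ES : List V → ℕ, ∃ DS, DValid G DS ∧
      playScore ES DS v ≤ graphDiam G + distDiametral G v + 1 := fun ES =>
    (exists_director_le_ncard G hU hc hvU ES).imp fun _ h => ⟨h.1, h.2.trans hUc⟩
  have hle : ∀ r ∈ {r : ℕ | ∃ ES : List V → ℕ, EValid G ES ∧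
      r = sInf {s : ℕ | ∃ DS : List V → ℕ → V, DValid G DS ∧ s = playScore ES DS v}},
      r ≤ graphDiam G + distDiametral G v + 1 := by
    rintro r ⟨ES, -, rfl⟩
    obtain ⟨DS, hDS, h⟩ := hup ES
    exact le_trans (Nat.sInf_le ⟨DS, hDS, rfl⟩) h
  change fd G v = graphDiam G + distDiametral G v + 1
  obtain ⟨ES, hES, hlow⟩ := exists_explorer_graphDiam_le_playScore G hc ha v
  refine le_antisymm (csSup_le' hle) (le_trans ?_ (le_csSup ⟨_, hle⟩ ⟨ES, hES, rfl⟩))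
  obtain ⟨DS, hDS, -⟩ := hup ES
  refine le_csInf ⟨_, DS, hDS, rfl⟩ ?_
  rintro s ⟨DS, hDS, rfl⟩
  exact hlow DS hDS
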